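/- Every hyperantihole A contains the complete graph K_{χ(A)} as a minor; that is, there exist χ(A) pairwise disjoint nonempty subsets of V(A), each inducing a connected subgraph, with at least one edge of A between every two of them. -/

import Mathlib

open SimpleGraph

/-- The closed neighborhood `N_G[v]` of a vertex `v`. -/
def closedNbhd {V : Type} (G : SimpleGraph V) (v : V) : Set V :=
  insert v (G.neighborSet v)

/-- `X` (indexed cyclically by `ZMod k`) is a ring partition of `G`:
a partition into `k` nonempty sets, each of which can be ordered so that the
closed neighborhoods are nested, with the last one covering `X i` and the first
one being exactly `X (i-1) ∪ X i ∪ X (i+1)`. -/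
def IsRingPartition {V : Type} (G : SimpleGraph V) (k : ℕ) (X : ZMod k → Set V) : Prop :=
  (∀ i, (X i).Nonempty) ∧
  (∀ v : V, ∃! i, v ∈ X i) ∧
  ∀ i, ∃ (m : ℕ) (hm : 0 < m) (u : Fin m → V),
    Function.Injective u ∧
    Set.range u = X i ∧
    (∀ j j' : Fin m, j ≤ j' → closedNbhd G (u j') ⊆ closedNbhd G (u j)) ∧
    X i ⊆ closedNbhd G (u ⟨m - 1, by omega⟩) ∧
    closedNbhd G (u ⟨0, hm⟩) = X (i - 1) ∪ X i ∪ X (i + 1)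

/-- `G` is a `k`-ring. -/
def IsRing {V : Type} (G : SimpleGraph V) (k : ℕ) : Prop :=
  ∃ X : ZMod k → Set V, IsRingPartition G k X

/-- `X` is a hyperhole partition of `G`: a partition into `k` nonempty cliques,
each complete to the two neighboring cliques and anticomplete to all remaining
vertices. -/
def IsHyperholePartition {V : Type} (G : SimpleGraph V) (k : ℕ) (X : ZMod k → Set V) : Prop :=
  (∀ i, (X i).Nonempty) ∧
  (∀ v : V, ∃! i, v ∈ X i) ∧
  (∀ i, G.IsClique (X i)) ∧
  (∀ i, ∀ x ∈ X i, ∀ y ∈ X (i - 1) ∪ X (i + 1), G.Adj x y) ∧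
  (∀ i, ∀ x ∈ X i, ∀ y, y ∉ X (i - 1) ∪ X i ∪ X (i + 1) → ¬ G.Adj x y)

/-- `G` is a `k`-hyperhole. -/
def IsHyperhole {V : Type} (G : SimpleGraph V) (k : ℕ) : Prop :=
  ∃ X : ZMod k → Set V, IsHyperholePartition G k X

/-- `X` is a hyperantihole partition of `G`: a partition into `k` nonempty cliques,
each complete to all vertices outside the two neighboring cliques (and itself),
and anticomplete to the two neighboring cliques. -/
def IsHyperantiholePartition {V : Type} (G : SimpleGraph V) (k : ℕ) (X : ZMod k → Set V) : Prop :=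
  (∀ i, (X i).Nonempty) ∧
  (∀ v : V, ∃! i, v ∈ X i) ∧
  (∀ i, G.IsClique (X i)) ∧
  (∀ i, ∀ x ∈ X i, ∀ y, y ∉ X (i - 1) ∪ X i ∪ X (i + 1) → G.Adj x y) ∧
  (∀ i, ∀ x ∈ X i, ∀ y ∈ X (i - 1) ∪ X (i + 1), ¬ G.Adj x y)

/-- `G` is a `k`-hyperantihole. -/
def IsHyperantihole {V : Type} (G : SimpleGraph V) (k : ℕ) : Prop :=
  ∃ X : ZMod k → Set V, IsHyperantiholePartition G k X

/-- A vertex is simplicial if its neighborhood is a clique. -/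
def IsSimplicial {V : Type} (G : SimpleGraph V) (v : V) : Prop :=
  G.IsClique (G.neighborSet v)

/-- A graph is perfect if every induced subgraph has chromatic number equal to
its clique number. -/
def IsPerfect {V : Type} (G : SimpleGraph V) : Prop :=
  ∀ S : Set V, (G.induce S).chromaticNumber = ((G.induce S).cliqueNum : ℕ∞)

/-- The function `f_k`: `⌊kn/(k-1)⌋` if `n ≡ 0, 1 (mod k-1)`, and `⌈kn/(k-1)⌉`
otherwise. -/
def ringF (k n : ℕ) : ℕ :=
  if n % (k - 1) ≤ 1 then k * n / (k - 1) else (k * n + (k - 2)) / (k - 1)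

/-- The function `g_k`: `⌊kn/(k-1)⌋` if `n mod (k-1) ∈ {0, …, (k-3)/2}`, and
`⌈kn/(k-1)⌉` if `n mod (k-1) ∈ {(k-1)/2, …, k-2}`. -/
def ringG (k n : ℕ) : ℕ :=
  if n % (k - 1) ≤ (k - 3) / 2 then k * n / (k - 1) else (k * n + (k - 2)) / (k - 1)

/-- The function `f_T`: `⌊5n/4⌋` if `n ≡ 0, 1 (mod 4)`, and `⌈5n/4⌉` if
`n ≡ 2, 3 (mod 4)`. -/
def fT (n : ℕ) : ℕ :=
  if n % 4 ≤ 1 then 5 * n / 4 else (5 * n + 3) / 4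

/-- `G` contains the complete graph `K_m` as a minor, witnessed by `m` pairwise
disjoint nonempty branch sets, each inducing a connected subgraph, with an edge
between every two of them. -/
def HasCompleteMinor {V : Type} (G : SimpleGraph V) (m : ℕ) : Prop :=
  ∃ S : Fin m → Set V,
    (∀ i, (S i).Nonempty) ∧
    (∀ i j, i ≠ j → Disjoint (S i) (S j)) ∧
    (∀ i, (G.induce (S i)).Connected) ∧
    (∀ i j, i ≠ j → ∃ x ∈ S i, ∃ y ∈ S j, G.Adj x y)

/-- `i` and `j` are consecutive on the cycle `0, 1, …, k - 1`. -/
def CyclicConsecutive (k i j : ℕ) : Prop :=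
  j = i + 1 ∨ i = j + 1 ∨ (i = 0 ∧ j + 1 = k) ∨ (j = 0 ∧ i + 1 = k)

/-- `S` contains no two consecutive natural numbers. -/
def PathStable (S : Finset ℕ) : Prop := ∀ i ∈ S, i + 1 ∉ S

/-- The greedy matching on a blow-up of a path with class sizes `y`: `greedyMatching y j` is the
number of matching edges between the classes `j - 1` and `j`. -/
def greedyMatching (y : ℕ → ℕ) : ℕ → ℕ
  | 0 => 0
  | r + 1 => min (y r - greedyMatching y r) (y (r + 1))

theorem greedyMatching_le (y : ℕ → ℕ) (r : ℕ) : greedyMatching y r ≤ y r := by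
  cases r <;> simp [greedyMatching]

theorem greedyMatching_add_le (y : ℕ → ℕ) (r : ℕ) :
    greedyMatching y r + greedyMatching y (r + 1) ≤ y r := by
  have h := greedyMatching_le y r
  have h' : greedyMatching y (r + 1) ≤ y r - greedyMatching y r := min_le_left _ _
  omega

theorem exists_pathStable_sum_add_greedyMatching (y : ℕ → ℕ) (r : ℕ) :
    ∃ S ⊆ Finset.range r, PathStable S ∧
      ∑ i ∈ S, y i + ∑ i ∈ Finset.range r, greedyMatching y i = ∑ i ∈ Finset.range r, y i := by
  induction r using Nat.twoStepInduction with
  | zero => exact ⟨∅, by simp, by simp [PathStable], by simp⟩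
  | one => exact ⟨{0}, by simp, by simp [PathStable], by simp [greedyMatching]⟩
  | more r ih₁ ih₂ =>
    obtain ⟨S, hS, hSs, hSw⟩ := ih₁
    obtain ⟨T, hT, hTs, hTw⟩ := ih₂
    have h := greedyMatching_le y r
    rcases le_total (y r - greedyMatching y r) (y (r + 1)) with hle | hle
    · have hx : greedyMatching y (r + 1) = y r - greedyMatching y r := min_eq_left hle
      have hlt : ∀ i ∈ S, i < r := fun i hi => Finset.mem_range.1 (hS hi)
      refine ⟨insert (r + 1) S, ?_, ?_, ?_⟩
      · intro i hi
        rcases Finset.mem_insert.1 hi with rfl | hi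
        · simp
        · have := hlt i hi
          simp only [Finset.mem_range]
          omega
      · intro i hi hi'
        rcases Finset.mem_insert.1 hi with rfl | hi
        · rcases Finset.mem_insert.1 hi' with h' | h'
          · omega
          · have := hlt _ h'
            omega
        · rcases Finset.mem_insert.1 hi' with h' | h'
          · have := hlt _ hi
            omega
          · exact hSs i hi h'
      · rw [Finset.sum_insert (fun h' => by have := hlt _ h'; omega), Finset.sum_range_succ,
          Finset.sum_range_succ, Finset.sum_range_succ _ (r + 1), Finset.sum_range_succ _ r, hx]
        omega
    · have hx : greedyMatching y (r + 1) = y (r + 1) := min_eq_right hle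
      refine ⟨T, hT.trans (by simp), hTs, ?_⟩
      rw [Finset.sum_range_succ, Finset.sum_range_succ _ (r + 1), hx]
      omega

/-- Uncrossing of a stable set of the path `0, …, k - 1` containing both ends with one
containing neither. -/
theorem sum_add_sum_le_of_ends {k m : ℕ} (hk : 2 ≤ k) (y : ℕ → ℕ)
    (hm : ∀ S ⊆ Finset.range k, PathStable S → ¬ (0 ∈ S ∧ k - 1 ∈ S) → ∑ i ∈ S, y i ≤ m)
    (hodd : Odd k → ∑ i ∈ Finset.range k, y i ≤ 2 * m)
    {B N : Finset ℕ} (hB : B ⊆ Finset.range k) (hN : N ⊆ Finset.range k)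
    (hBs : PathStable B) (hNs : PathStable N) (hB0 : 0 ∈ B) (hBk : k - 1 ∈ B)
    (hN0 : 0 ∉ N) (hNk : k - 1 ∉ N) :
    ∑ i ∈ B, y i + ∑ i ∈ N, y i ≤ 2 * m := by
  by_cases hj : ∃ j, j + 1 < k ∧ ¬ (j ∈ B ∧ j + 1 ∈ N) ∧ ¬ (j ∈ N ∧ j + 1 ∈ B)
  · obtain ⟨j, hjk, h₁, h₂⟩ := hj
    have key : ∀ P Q : Finset ℕ, P ⊆ Finset.range k → Q ⊆ Finset.range k → PathStable P →
        PathStable Q → ¬ (0 ∈ P ∧ k - 1 ∈ Q) → ¬ (j ∈ P ∧ j + 1 ∈ Q) →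
        ∑ i ∈ P with i ≤ j, y i + ∑ i ∈ Q with ¬ i ≤ j, y i ≤ m := by
      intro P Q hP hQ hPs hQs h0 hPQ
      rw [← Finset.sum_union (Finset.disjoint_left.2 fun i hi hi' => by
        simp only [Finset.mem_filter] at hi hi'; exact hi'.2 hi.2)]
      apply hm
      · exact Finset.union_subset ((Finset.filter_subset _ _).trans hP)
          ((Finset.filter_subset _ _).trans hQ)
      · intro i hi hi'
        simp only [Finset.mem_union, Finset.mem_filter] at hi hi'
        rcases hi with ⟨hi, hij⟩ | ⟨hi, hij⟩ <;> rcases hi' with ⟨hi', hij'⟩ | ⟨hi', hij'⟩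
        · exact hPs i hi hi'
        · obtain rfl : i = j := by omega
          exact hPQ ⟨hi, hi'⟩
        · omega
        · exact hQs i hi hi'
      · simp only [Finset.mem_union, Finset.mem_filter]
        rintro ⟨⟨h, -⟩ | ⟨-, h⟩, ⟨-, h'⟩ | ⟨h', -⟩⟩
        · omega
        · exact h0 ⟨h, h'⟩
        · omega
        · omega
    have hBN := key B N hB hN hBs hNs (fun h => hNk h.2) h₁
    have hNB := key N B hN hB hNs hBs (fun h => hN0 h.1) h₂
    have e₁ := Finset.sum_filter_add_sum_filter_not B (· ≤ j) y
    have e₂ := Finset.sum_filter_add_sum_filter_not N (· ≤ j) y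
    omega
  · push Not at hj
    have alt : ∀ j < k, (Even j → j ∈ B ∧ j ∉ N) ∧ (¬ Even j → j ∈ N ∧ j ∉ B) := by
      intro j
      induction j with
      | zero => exact fun _ => ⟨fun _ => ⟨hB0, hN0⟩, fun h => absurd Even.zero h⟩
      | succ j ih =>
        intro hjk
        obtain ⟨ih₁, ih₂⟩ := ih (by omega)
        have hj' := hj j hjk
        rw [Nat.even_add_one, not_not]
        constructor
        · intro h
          obtain ⟨hjN, hjB⟩ := ih₂ h
          exact ⟨(hj' fun h' => absurd h' hjB).2, hNs j hjN⟩
        · intro h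
          obtain ⟨hjB, hjN⟩ := ih₁ h
          refine ⟨?_, hBs j hjB⟩
          by_contra hc
          exact hjN (hj' fun _ => hc).1
    have hkodd : Odd k := by
      by_contra hc
      have h : ¬ Even (k - 1) := by
        rw [Nat.not_odd_iff_even] at hc
        rw [Nat.not_even_iff_odd]
        exact Nat.Even.sub_odd (by omega) hc odd_one
      exact ((alt (k - 1) (by omega)).2 h).2 hBk
    have hd : Disjoint B N := Finset.disjoint_left.2 fun i hi hi' => by
      have h := alt i (Finset.mem_range.1 (hB hi))
      tauto
    rw [← Finset.sum_union hd]
    exact (Finset.sum_le_sum_of_subset (Finset.union_subset hB hN)).trans (hodd hkodd)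

/-- A large matching in a blow-up of a cycle with class sizes `y`: here `x j` is the number of
matching edges between the class `j` and its predecessor. -/
theorem exists_cyclic_matching {k m : ℕ} (hk : 2 ≤ k) (y : ℕ → ℕ) (hy : y 0 ≤ y (k - 1))
    (hm : ∀ S ⊆ Finset.range k, PathStable S → ¬ (0 ∈ S ∧ k - 1 ∈ S) → ∑ i ∈ S, y i ≤ m)
    (hodd : Odd k → ∑ i ∈ Finset.range k, y i ≤ 2 * m) :
    ∃ x : ℕ → ℕ, (∀ j, j + 1 < k → x j + x (j + 1) ≤ y j) ∧ x (k - 1) + x 0 ≤ y (k - 1) ∧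
      ∑ i ∈ Finset.range k, y i ≤ m + ∑ i ∈ Finset.range k, x i := by
  obtain ⟨l, rfl⟩ : ∃ l, k = l + 2 := ⟨k - 2, by omega⟩
  simp only [Nat.add_succ_sub_one] at *
  obtain ⟨t, hty, htN, htB⟩ : ∃ t, t ≤ y 0 ∧
      (∀ S ⊆ Finset.range (l + 2), PathStable S → 0 ∉ S → l + 1 ∉ S → ∑ i ∈ S, y i + t ≤ m) ∧
      (∀ S ⊆ Finset.range (l + 2), PathStable S → 0 ∈ S → l + 1 ∈ S →
        ∑ i ∈ S, y i ≤ m + t) := by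
    classical
    let F := (Finset.range (l + 2)).powerset.filter
      fun S => PathStable S ∧ 0 ∉ S ∧ l + 1 ∉ S
    have hF : F.Nonempty := ⟨∅, by
      simp only [F, Finset.mem_filter, Finset.mem_powerset]
      simp [PathStable]⟩
    obtain ⟨N, hNF, hmax⟩ := F.exists_max_image (fun S => ∑ i ∈ S, y i) hF
    simp only [F, Finset.mem_filter, Finset.mem_powerset] at hNF hmax
    obtain ⟨hN, hNs, hN0, hNk⟩ := hNF
    have hNm := hm N hN hNs (fun h => hN0 h.1)
    refine ⟨min (y 0) (m - ∑ i ∈ N, y i), min_le_left _ _, ?_, ?_⟩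
    · intro S hS hSs h0 hl
      have h := hmax S ⟨hS, hSs, h0, hl⟩
      have := min_le_right (y 0) (m - ∑ i ∈ N, y i)
      omega
    · intro S hS hSs h0 hl
      have h₁ := sum_add_sum_le_of_ends hk y (by simpa using hm) hodd hS hN hSs hNs h0
        (by simpa using hl) hN0 (by simpa using hNk)
      have h₂ := hm (S.erase 0) ((Finset.erase_subset _ _).trans hS)
        (fun i hi hi' => hSs i (Finset.mem_of_mem_erase hi) (Finset.mem_of_mem_erase hi'))
        (fun h => by simp at h)
      have h₃ := Finset.add_sum_erase S y h0
      rcases min_choice (y 0) (m - ∑ i ∈ N, y i) with h | h <;> rw [h] <;> omega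
  let y' : ℕ → ℕ := fun j => if j = 0 ∨ j = l + 1 then y j - t else y j
  have hy'0 : y' 0 = y 0 - t := by simp [y']
  have hy'l : y' (l + 1) = y (l + 1) - t := by simp [y']
  have hy'm : ∀ j, j ≠ 0 → j ≠ l + 1 → y' j = y j := fun j h h' => by simp [y', h, h']
  have hsum : ∀ S : Finset ℕ, ∑ i ∈ S, y' i + (if 0 ∈ S then t else 0) +
      (if l + 1 ∈ S then t else 0) = ∑ i ∈ S, y i := by
    intro S
    rw [← Finset.sum_ite_eq' S 0 (fun _ => t), ← Finset.sum_ite_eq' S (l + 1) (fun _ => t),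
      ← Finset.sum_add_distrib, ← Finset.sum_add_distrib]
    refine Finset.sum_congr rfl fun i _ => ?_
    by_cases h0 : i = 0
    · subst h0
      simp [hy'0]
      omega
    · by_cases hl : i = l + 1
      · subst hl
        simp [hy'l]
        omega
      · simp [h0, hl, hy'm i h0 hl]
  obtain ⟨S, hS, hSs, hSw⟩ := exists_pathStable_sum_add_greedyMatching y' (l + 2)
  refine ⟨fun j => if j = 0 then t else greedyMatching y' j, ?_, ?_, ?_⟩
  · intro j hj
    have h := greedyMatching_add_le y' j
    by_cases h0 : j = 0
    · subst h0
      simp only [hy'0] at h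
      simp only [if_true, Nat.add_eq_zero_iff, one_ne_zero, and_false, if_false]
      omega
    · rw [hy'm j h0 (by omega)] at h
      simpa [h0] using h
  · have h := greedyMatching_le y' (l + 1)
    simp only [if_true, Nat.add_eq_zero_iff, one_ne_zero, and_false, if_false]
    omega
  · have hx : ∑ i ∈ Finset.range (l + 2), (if i = 0 then t else greedyMatching y' i) =
        ∑ i ∈ Finset.range (l + 2), greedyMatching y' i + t := by
      rw [Finset.sum_range_succ', Finset.sum_range_succ' (greedyMatching y')]
      simp [show greedyMatching y' 0 = 0 from rfl]
    rw [hx]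
    have h₁ := hsum S
    have h₂ := hsum (Finset.range (l + 2))
    simp only [Finset.mem_range] at h₂
    rw [if_pos (by omega), if_pos (by omega)] at h₂
    have hc := hm S hS hSs
    have hN := htN S hS hSs
    have hB := htB S hS hSs
    by_cases h0 : 0 ∈ S <;> by_cases hl : l + 1 ∈ S <;>
      simp only [h0, hl, if_true, if_false, not_true, not_false_iff, and_true,
        and_false, forall_const, false_imp_iff] at h₁ hc hN hB <;> omega

/-- Colour classes of size two obtained from a matching in the complement of `G`: `x (σ i)`
of them consist of one vertex in the class `i` and one in the class `σ i`. -/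
theorem exists_coloring_of_matching {V I : Type} [Fintype I] [DecidableEq V] [DecidableEq I]
    (G : SimpleGraph V) (g : V → I) (σ : Equiv.Perm I) (hσ : ∀ i, σ i ≠ i)
    (hG : ∀ u v, g v = σ (g u) → ¬ G.Adj u v) (N : ℕ) :
    ∀ (s : Finset V) (x : I → ℕ), ∑ i, x i = N →
      (∀ i, x i + x (σ i) ≤ (s.filter fun v => g v = i).card) →
      ∃ c : V → ℕ, (∀ v ∈ s, c v + N < s.card) ∧
        ∀ u ∈ s, ∀ v ∈ s, G.Adj u v → c u ≠ c v := by
  induction N with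
  | zero =>
    intro s x _ _
    refine ⟨fun v => if h : v ∈ s then (s.equivFin ⟨v, h⟩).val else 0, ?_, ?_⟩
    · intro v hv
      simp [hv]
    · intro u hu v hv huv h
      simp only [hu, hv, dif_pos] at h
      have := s.equivFin.injective (Fin.ext h)
      exact huv.ne (by simpa using this)
  | succ N ih =>
    intro s x hx hs
    obtain ⟨e, -, he⟩ : ∃ e ∈ Finset.univ, 0 < x e := by
      apply Finset.exists_lt_of_sum_lt (f := fun _ => 0)
      simp [hx]
    obtain ⟨j, rfl⟩ := σ.surjective e
    obtain ⟨u, hu⟩ : (s.filter fun v => g v = j).Nonempty := by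
      rw [← Finset.card_pos]
      have := hs j
      omega
    obtain ⟨v, hv⟩ : (s.filter fun v => g v = σ j).Nonempty := by
      rw [← Finset.card_pos]
      have := hs (σ j)
      omega
    rw [Finset.mem_filter] at hu hv
    have huv : u ≠ v := by
      rintro rfl
      exact hσ j (hv.2.symm.trans hu.2)
    have hadj : ¬ G.Adj u v := hG u v (by rw [hu.2, hv.2])
    let x' := Function.update x (σ j) (x (σ j) - 1)
    have hx' : ∑ i, x' i = N := by
      have h₁ := Finset.add_sum_erase Finset.univ x (Finset.mem_univ (σ j))
      have h₂ := Finset.sum_update_of_mem (Finset.mem_univ (σ j)) x (x (σ j) - 1)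
      rw [Finset.sdiff_singleton_eq_erase] at h₂
      change ∑ i, x' i = _ at h₂
      omega
    have hu' : u ∈ s.erase v := Finset.mem_erase.2 ⟨huv, hu.1⟩
    have hcard : ((s.erase v).erase u).card + 2 = s.card := by
      have h₁ := Finset.card_erase_add_one hv.1
      have h₂ := Finset.card_erase_add_one hu'
      omega
    obtain ⟨c, hc, hc'⟩ := ih ((s.erase v).erase u) x' hx' (by
      intro i
      have h := hs i
      rw [Finset.filter_erase, Finset.filter_erase]
      by_cases hi : i = j
      · subst hi
        rw [Finset.erase_eq_of_notMem (a := v)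
          (by simp only [Finset.mem_filter]; rintro ⟨-, h'⟩; exact hσ i (hv.2.symm.trans h')),
          Finset.card_erase_of_mem (by simp [hu])]
        simp only [x', Function.update_self, Function.update_of_ne (hσ i).symm]
        omega
      · have h₁ : σ i ≠ σ j := fun h' => hi (σ.injective h')
        rw [Finset.erase_eq_of_notMem (a := u)
          (by
            simp only [Finset.mem_erase, Finset.mem_filter]
            rintro ⟨-, -, h'⟩
            exact hi (h'.symm.trans hu.2))]
        by_cases hi' : i = σ j
        · subst hi'
          rw [Finset.card_erase_of_mem (by simp [hv])]
          simp only [x', Function.update_self, Function.update_of_ne h₁]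
          omega
        · rw [Finset.erase_eq_of_notMem
            (by simp only [Finset.mem_filter]; rintro ⟨-, h'⟩; exact hi' (h'.symm.trans hv.2))]
          simpa only [x', Function.update_of_ne h₁, Function.update_of_ne hi'] using h)
    have hpos : N + 1 < s.card := by
      have h₁ := Finset.sum_le_sum fun i (_ : i ∈ Finset.univ) => hs i
      rw [Finset.sum_add_distrib, Equiv.sum_comp σ x, hx,
        ← Finset.card_eq_sum_card_fiberwise (fun v _ => by simp)] at h₁
      omega
    refine ⟨fun w => if w = u ∨ w = v then s.card - (N + 1) - 1 else c w, ?_, ?_⟩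
    · intro w hw
      by_cases h : w = u ∨ w = v
      · simp only [h, if_true]
        omega
      · simp only [h, if_false]
        push Not at h
        have := hc w (by simp [h, hw])
        omega
    · intro w hw z hz hwz
      by_cases h : w = u ∨ w = v <;> by_cases h' : z = u ∨ z = v <;>
        simp only [h, h', if_true, if_false]
      · exfalso
        rcases h with rfl | rfl <;> rcases h' with rfl | rfl
        · exact hwz.ne rfl
        · exact hadj hwz
        · exact hadj hwz.symm
        · exact hwz.ne rfl
      · push Not at h'
        have := hc z (by simp [h', hz])
        omega
      · push Not at h
        have := hc w (by simp [h, hw])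
        omega
      · push Not at h h'
        exact hc' w (by simp [h, hw]) z (by simp [h', hz]) hwz

theorem HasCompleteMinor.of_family {V ι : Type} [Fintype ι] {G : SimpleGraph V} {m : ℕ}
    (hm : m ≤ Fintype.card ι) (S : ι → Set V) (hdisj : ∀ i j, i ≠ j → Disjoint (S i) (S j))
    (hconn : ∀ i, (G.induce (S i)).Connected)
    (hadj : ∀ i j, i ≠ j → ∃ x ∈ S i, ∃ y ∈ S j, G.Adj x y) : HasCompleteMinor G m := by
  let e : Fin m ↪ ι := (Fin.castLEEmb hm).trans (Fintype.equivFin ι).symm.toEmbedding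
  refine ⟨S ∘ e, fun i => ?_, fun i j h => hdisj _ _ (e.injective.ne h), fun i => hconn _,
    fun i j h => hadj _ _ (e.injective.ne h)⟩
  exact Set.nonempty_coe_sort.1 (hconn (e i)).nonempty

theorem HasCompleteMinor.mono {V : Type} {G : SimpleGraph V} {m n : ℕ}
    (h : HasCompleteMinor G m) (hnm : n ≤ m) : HasCompleteMinor G n := by
  obtain ⟨S, -, hd, hc, ha⟩ := h
  exact .of_family (by simpa using hnm) S hd hc ha

theorem connected_induce_singleton {V : Type} (G : SimpleGraph V) (v : V) :
    (G.induce {v}).Connected := by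
  rw [connected_iff]
  exact ⟨fun a b => by rw [Subsingleton.elim a b], ⟨v, rfl⟩⟩

theorem connected_induce_path {V : Type} {G : SimpleGraph V} {a b c : V}
    (hab : G.Adj a b) (hbc : G.Adj b c) : (G.induce {a, b, c}).Connected := by
  rw [connected_iff_exists_forall_reachable]
  refine ⟨⟨b, by simp⟩, ?_⟩
  rintro ⟨w, rfl | rfl | rfl⟩
  · exact Adj.reachable (by simpa using hab.symm)
  · exact Reachable.refl _
  · exact Adj.reachable (by simpa using hbc)

theorem card_subtype_mem_eq_sum {V : Type} [Fintype V] (f : V → ℕ) (C : Finset ℕ) :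
    Fintype.card {v // f v ∈ C} = ∑ i ∈ C, Fintype.card {v // f v = i} := by
  classical
  simp only [Fintype.card_subtype]
  rw [Finset.card_eq_sum_card_fiberwise (f := f) (t := C) (fun v hv => by simpa using hv)]
  refine Finset.sum_congr rfl fun i hi => ?_
  congr 1
  ext v
  simp only [Finset.mem_filter, Finset.mem_univ, true_and]
  exact ⟨fun h => h.2, fun h => ⟨h ▸ hi, h⟩⟩

section Blowup

variable {V : Type} {A : SimpleGraph V} {k : ℕ} {f : V → ℕ}

theorem adj_of_mem_stable (hA : ∀ u v, u ≠ v → ¬ CyclicConsecutive k (f u) (f v) → A.Adj u v)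
    {C : Finset ℕ} (hCk : C ⊆ Finset.range k) (hC : PathStable C)
    (hC0 : ¬ (0 ∈ C ∧ k - 1 ∈ C)) {u v : V} (huv : u ≠ v) (hu : f u ∈ C) (hv : f v ∈ C) :
    A.Adj u v := by
  refine hA u v huv ?_
  have hu' := Finset.mem_range.1 (hCk hu)
  have hv' := Finset.mem_range.1 (hCk hv)
  rintro (h | h | ⟨h, h'⟩ | ⟨h, h'⟩)
  · exact hC _ hu (h ▸ hv)
  · exact hC _ hv (h ▸ hu)
  · exact hC0 ⟨h ▸ hu, (by omega : k - 1 = f v) ▸ hv⟩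
  · exact hC0 ⟨h ▸ hv, (by omega : k - 1 = f u) ▸ hu⟩

theorem hasCompleteMinor_of_stable [Fintype V]
    (hA : ∀ u v, u ≠ v → ¬ CyclicConsecutive k (f u) (f v) → A.Adj u v)
    {C : Finset ℕ} (hCk : C ⊆ Finset.range k) (hC : PathStable C)
    (hC0 : ¬ (0 ∈ C ∧ k - 1 ∈ C)) :
    HasCompleteMinor A (∑ i ∈ C, Fintype.card {v // f v = i}) := by
  classical
  refine .of_family (ι := {v // f v ∈ C}) (card_subtype_mem_eq_sum f C).ge (fun v => {v.1})
    (fun u v h => by simpa [Subtype.ext_iff] using h)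
    (fun v => connected_induce_singleton A v) (fun u v h => ⟨u, rfl, v, rfl, ?_⟩)
  exact adj_of_mem_stable hA hCk hC hC0 (fun h' => h (Subtype.ext h')) u.2 v.2

/-- A clique on the classes in `C`, together with branch sets consisting of one vertex from each
of the classes `0`, `a` and `b`. -/
theorem hasCompleteMinor_of_stable_add [Fintype V]
    (hA : ∀ u v, u ≠ v → ¬ CyclicConsecutive k (f u) (f v) → A.Adj u v)
    {C : Finset ℕ} (hCk : C ⊆ Finset.range k) (hC : PathStable C) (h0 : 0 ∉ C)
    {a b : ℕ} (ha : a ∉ C) (hb : b ∉ C) (ha0 : a ≠ 0) (hb0 : b ≠ 0) (hab : a ≠ b)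
    (hca : ¬ CyclicConsecutive k 0 a) (hcab : ¬ CyclicConsecutive k a b)
    (hk : k ≠ 1)
    (hdom : ∀ c ∈ C, ¬ CyclicConsecutive k 0 c ∨ ¬ CyclicConsecutive k b c)
    (hya : Fintype.card {v // f v = 0} ≤ Fintype.card {v // f v = a})
    (hyb : Fintype.card {v // f v = 0} ≤ Fintype.card {v // f v = b}) :
    HasCompleteMinor A
      (∑ i ∈ C, Fintype.card {v // f v = i} + Fintype.card {v // f v = 0}) := by
  classical
  obtain ⟨p⟩ := Function.Embedding.nonempty_of_card_le hya
  obtain ⟨q⟩ := Function.Embedding.nonempty_of_card_le hyb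
  have hne : ∀ {u v : V}, f u ≠ f v → u ≠ v := fun h h' => h (congrArg f h')
  have hdom' : ∀ (c : {v // f v ∈ C}) (z : {v // f v = 0}),
      ∃ x ∈ ({z.1, (p z).1, (q z).1} : Set V), A.Adj x c := by
    intro c z
    rcases hdom _ c.2 with h | h
    · exact ⟨z, by simp, hA _ _ (hne fun h' => h0 (by rw [← z.2, h']; exact c.2))
        (by rwa [z.2])⟩
    · exact ⟨q z, by simp, hA _ _ (hne fun h' => hb (by rw [← (q z).2, h']; exact c.2))
        (by rwa [(q z).2])⟩
  have hdisj : ∀ (c : {v // f v ∈ C}) (z : {v // f v = 0}),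
      c.1 ∉ ({z.1, (p z).1, (q z).1} : Set V) := by
    rintro ⟨c, hc⟩ z (h | h | h) <;> simp only at h <;> subst h
    · exact h0 (z.2 ▸ hc)
    · exact ha ((p z).2 ▸ hc)
    · exact hb ((q z).2 ▸ hc)
  refine .of_family (ι := {v // f v ∈ C} ⊕ {v // f v = 0})
    (by rw [Fintype.card_sum, card_subtype_mem_eq_sum])
    (Sum.elim (fun v => {v.1}) fun z => {z.1, (p z).1, (q z).1}) ?_ ?_ ?_
  · rintro (c | z) (c' | z') h
    · simpa [Subtype.ext_iff] using h
    · exact Set.disjoint_singleton_left.2 (hdisj c z')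
    · exact Set.disjoint_singleton_right.2 (hdisj c' z)
    · have hz : z ≠ z' := fun h' => h (congrArg _ h')
      have hp : (p z).1 ≠ (p z').1 := fun h' => hz (p.injective (Subtype.ext h'))
      have hq : (q z).1 ≠ (q z').1 := fun h' => hz (q.injective (Subtype.ext h'))
      have hz' : z.1 ≠ z'.1 := fun h' => hz (Subtype.ext h')
      refine Set.disjoint_left.2 ?_
      rintro w hw hw'
      simp only [Sum.elim_inr, Set.mem_insert_iff, Set.mem_singleton_iff] at hw hw'
      have e₁ := z.2
      have e₂ := z'.2
      have e₃ := (p z).2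
      have e₄ := (p z').2
      have e₅ := (q z).2
      have e₆ := (q z').2
      rcases hw with rfl | rfl | rfl <;> rcases hw' with h | h | h <;>
        first
        | exact absurd h ‹_›
        | (have := congrArg f h; omega)
  · rintro (c | z)
    · exact connected_induce_singleton A c
    · refine connected_induce_path (hA _ _ (hne ?_) ?_) (hA _ _ (hne ?_) ?_)
      · rw [z.2, (p z).2]
        exact ha0.symm
      · rwa [z.2, (p z).2]
      · rwa [(p z).2, (q z).2]
      · rwa [(p z).2, (q z).2]
  · rintro (c | z) (c' | z') h
    · exact ⟨c, rfl, c', rfl, adj_of_mem_stable hA hCk hC (fun h => h0 h.1)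
        (fun h' => h (congrArg _ (Subtype.ext h'))) c.2 c'.2⟩
    · obtain ⟨x, hx, hxc⟩ := hdom' c z'
      exact ⟨c, rfl, x, hx, hxc.symm⟩
    · obtain ⟨x, hx, hxc⟩ := hdom' c' z
      exact ⟨x, hx, c', rfl, hxc⟩
    · refine ⟨z, by simp, z', by simp, hA _ _ (fun h' => h (congrArg _ (Subtype.ext h'))) ?_⟩
      rw [z.2, z'.2]
      rintro (h | h | h | h) <;> omega

theorem hasCompleteMinor_half [Fintype V]
    (hA : ∀ u v, u ≠ v → ¬ CyclicConsecutive k (f u) (f v) → A.Adj u v)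
    (hk : 5 ≤ k) (hodd : Odd k) (hf : ∀ v, f v < k)
    (hmin : ∀ i < k, Fintype.card {v // f v = 0} ≤ Fintype.card {v // f v = i}) :
    HasCompleteMinor A ((Fintype.card V + 1) / 2) := by
  classical
  obtain ⟨t, rfl⟩ := hodd
  let C := (Finset.range (2 * t + 1)).filter Odd
  let D := (Finset.range (2 * t + 1)).filter fun i => Even i ∧ i ≠ 0
  have hC : ∀ {i}, i ∈ C ↔ i < 2 * t + 1 ∧ i % 2 = 1 := by
    intro i
    simp only [C, Finset.mem_filter, Finset.mem_range, Nat.odd_iff]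
  have hD : ∀ {i}, i ∈ D ↔ i < 2 * t + 1 ∧ i % 2 = 0 ∧ i ≠ 0 := by
    intro i
    simp only [D, Finset.mem_filter, Finset.mem_range, Nat.even_iff]
  have hCm := hasCompleteMinor_of_stable_add hA (C := C) (a := 2) (b := 4)
    (Finset.filter_subset _ _)
    (by intro i; simp only [hC]; omega) (by simp only [hC]; omega) (by simp only [hC]; omega)
    (by simp only [hC]; omega) (by omega) (by omega) (by omega)
    (by simp only [CyclicConsecutive]; omega) (by simp only [CyclicConsecutive]; omega)
    (by omega) (by intro c; simp only [hC, CyclicConsecutive]; omega)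
    (hmin _ (by omega)) (hmin _ (by omega))
  have hDm := hasCompleteMinor_of_stable_add hA (C := D) (a := 2 * t - 1) (b := 2 * t - 3)
    (Finset.filter_subset _ _)
    (by intro i; simp only [hD]; omega) (by simp only [hD]; omega) (by simp only [hD]; omega)
    (by simp only [hD]; omega) (by omega) (by omega) (by omega)
    (by simp only [CyclicConsecutive]; omega) (by simp only [CyclicConsecutive]; omega)
    (by omega) (by intro c; simp only [hD, CyclicConsecutive]; omega)
    (hmin _ (by omega)) (hmin _ (by omega))
  have hsum : Fintype.card V = ∑ i ∈ C, Fintype.card {v // f v = i} +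
      (∑ i ∈ D, Fintype.card {v // f v = i} + Fintype.card {v // f v = 0}) := by
    have h0 : 0 ∉ D := by simp [hD]
    have hd : Disjoint C (insert 0 D) := Finset.disjoint_left.2 fun i hi hi' => by
      rw [Finset.mem_insert, hD] at hi'
      rw [hC] at hi
      omega
    rw [add_comm (∑ i ∈ D, _),
      ← Finset.sum_insert (f := fun i => Fintype.card {v // f v = i}) h0, ← Finset.sum_union hd,
      ← card_subtype_mem_eq_sum]
    refine (Fintype.card_of_subtype Finset.univ fun v => ?_).symm
    have := hf v
    simp only [Finset.mem_univ, Finset.mem_union, Finset.mem_insert, hC, hD, true_iff]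
    omega
  rcases le_total (∑ i ∈ C, Fintype.card {v // f v = i})
    (∑ i ∈ D, Fintype.card {v // f v = i}) with h | h
  · exact hDm.mono (by omega)
  · exact hCm.mono (by omega)

end Blowup

theorem ZMod.val_add_one_cases {k : ℕ} (hk : 2 ≤ k) (i : ZMod k) :
    (i.val + 1 < k ∧ (i + 1).val = i.val + 1) ∨ (i.val + 1 = k ∧ (i + 1).val = 0) := by
  have : NeZero k := ⟨by omega⟩
  have : Fact (1 < k) := ⟨by omega⟩
  have h := ZMod.val_add i 1
  rw [ZMod.val_one] at h
  rcases (Nat.succ_le_of_lt (ZMod.val_lt i)).lt_or_eq with hi | hi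
  · exact Or.inl ⟨hi, by rwa [Nat.mod_eq_of_lt hi] at h⟩
  · exact Or.inr ⟨hi, by rwa [show i.val + 1 = k from hi, Nat.mod_self] at h⟩

theorem ZMod.sum_val_eq_sum_range (k : ℕ) [NeZero k] (x : ℕ → ℕ) :
    ∑ i : ZMod k, x i.val = ∑ i ∈ Finset.range k, x i := by
  refine Finset.sum_nbij ZMod.val (fun i _ => by simpa using ZMod.val_lt i)
    ((ZMod.val_injective k).injOn) ?_ (fun _ _ => rfl)
  intro i hi
  exact ⟨i, by simp, ZMod.val_cast_of_lt (by simpa using hi)⟩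

/-- The index of each vertex, rotated so that the class of index `0` is smallest. -/
theorem IsHyperantihole.exists_index {V : Type} [Fintype V] {A : SimpleGraph V} {k : ℕ}
    (hk : 4 ≤ k) (hA : IsHyperantihole A k) :
    ∃ g : V → ZMod k, (∀ u v, g v = g u + 1 → ¬ A.Adj u v) ∧
      (∀ u v, u ≠ v → g v ≠ g u + 1 → g v ≠ g u - 1 → A.Adj u v) ∧
      ∀ i, Nat.card {v // g v = 0} ≤ Nat.card {v // g v = i} := by
  have : NeZero k := ⟨by omega⟩
  obtain ⟨X, -, hpart, hclique, hcompl, hanti⟩ := hA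
  choose idx hidx huniq using hpart
  simp only at hidx huniq
  obtain ⟨i₀, hi₀⟩ := Finite.exists_min fun i => Nat.card {v // idx v = i}
  refine ⟨fun v => idx v - i₀, ?_, ?_, ?_⟩
  · intro u v h
    refine hanti _ u (hidx u) v (Or.inr ?_)
    have : idx v = idx u + 1 := by linear_combination h
    exact this ▸ hidx v
  · intro u v huv h₁ h₂
    by_cases h : idx u = idx v
    · exact hclique _ (hidx u) (h ▸ hidx v) huv
    · refine hcompl _ u (hidx u) v ?_
      rintro ((h' | h') | h')
      · exact h₂ (by have := huniq v _ h'; linear_combination -this)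
      · exact h (huniq v _ h')
      · exact h₁ (by have := huniq v _ h'; linear_combination -this)
  · intro i
    simpa only [sub_eq_iff_eq_add, zero_add] using hi₀ (i + i₀)

/-- Every hyperantihole `A` contains the complete graph `K_{χ(A)}` as a minor. -/
theorem hyperantihole_hasCompleteMinor_chromaticNumber {V : Type} [Fintype V]
    (A : SimpleGraph V) (hA : ∃ k, 4 ≤ k ∧ IsHyperantihole A k) :
    ∃ n : ℕ, A.chromaticNumber = (n : ℕ∞) ∧ HasCompleteMinor A n := by
  classical
  obtain ⟨k, hk, hA⟩ := hA
  have : NeZero k := ⟨by omega⟩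
  have : Fact (1 < k) := ⟨by omega⟩
  obtain ⟨g, hg₁, hg₂, hmin⟩ := hA.exists_index hk
  let f : V → ℕ := fun v => (g v).val
  have hf : ∀ v, f v < k := fun v => ZMod.val_lt _
  have hadj : ∀ u v, u ≠ v → ¬ CyclicConsecutive k (f u) (f v) → A.Adj u v := by
    intro u v huv h
    refine hg₂ u v huv (fun h' => h ?_) (fun h' => h ?_)
    · have := ZMod.val_add_one_cases (by omega) (g u)
      rw [← h'] at this
      simp only [CyclicConsecutive, f]
      omega
    · have := ZMod.val_add_one_cases (by omega) (g v)
      rw [h', sub_add_cancel, ← h'] at this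
      simp only [CyclicConsecutive, f]
      omega
  have hval : ∀ (i : ZMod k) v, f v = i.val ↔ g v = i :=
    fun i v => (ZMod.val_injective k).eq_iff
  have hmin' : ∀ i < k, Fintype.card {v // f v = 0} ≤ Fintype.card {v // f v = i} := by
    intro i hi
    have h := hmin (i : ZMod k)
    rw [← Nat.card_eq_fintype_card, ← Nat.card_eq_fintype_card]
    simpa only [← hval, ZMod.val_zero, ZMod.val_cast_of_lt hi] using h
  let y : ℕ → ℕ := fun i => Fintype.card {v // f v = i}
  have hn : ∑ i ∈ Finset.range k, y i = Fintype.card V := by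
    rw [← card_subtype_mem_eq_sum]
    exact Fintype.card_of_subtype Finset.univ fun v => by simp [hf]
  obtain ⟨m, hm, hclique, hhalf⟩ : ∃ m, HasCompleteMinor A m ∧
      (∀ S ⊆ Finset.range k, PathStable S → ¬ (0 ∈ S ∧ k - 1 ∈ S) → ∑ i ∈ S, y i ≤ m) ∧
      (Odd k → ∑ i ∈ Finset.range k, y i ≤ 2 * m) := by
    refine ⟨Nat.findGreatest (HasCompleteMinor A) (Fintype.card V),
      Nat.findGreatest_spec (Nat.zero_le _)
        (.of_family (ι := Empty) (Nat.zero_le _) nofun nofun nofun nofun), ?_, ?_⟩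
    · intro S hS hSs hS0
      exact Nat.le_findGreatest (hn ▸ Finset.sum_le_sum_of_subset hS)
        (hasCompleteMinor_of_stable hadj hS hSs hS0)
    · intro hodd
      have h5 : 5 ≤ k := by
        obtain ⟨t, rfl⟩ := hodd
        omega
      have h := Nat.le_findGreatest (P := HasCompleteMinor A) (n := Fintype.card V) (by omega)
        (hasCompleteMinor_half hadj h5 hodd hf hmin')
      omega
  obtain ⟨x, hx₁, hx₂, hx₃⟩ :=
    exists_cyclic_matching (by omega) y (hmin' _ (by omega)) hclique hhalf
  obtain ⟨c, hc, hc'⟩ := exists_coloring_of_matching A g (Equiv.addRight 1) (by simp)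
    (fun u v h => hg₁ u v (by simpa using h)) _ Finset.univ (fun i => x i.val) rfl (by
      intro i
      have hy : (Finset.univ.filter fun v => g v = i).card = y i.val := by
        simp only [y, hval, Fintype.card_subtype]
      rw [hy, Equiv.coe_addRight]
      rcases ZMod.val_add_one_cases (by omega) i with ⟨h, h'⟩ | ⟨h, h'⟩ <;> rw [h']
      · exact hx₁ _ h
      · rwa [show i.val = k - 1 by omega])
  rw [ZMod.sum_val_eq_sum_range k x, Finset.card_univ] at hc
  have hcol : A.Colorable m := by
    rw [colorable_iff_exists_bdd_nat_coloring]
    refine ⟨Coloring.mk c fun {u v} h => hc' u (by simp) v (by simp) h, fun v => ?_⟩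
    have := hc v (by simp)
    change c v < m
    omega
  obtain ⟨n, hχ⟩ := ENat.ne_top_iff_exists.1 (chromaticNumber_ne_top_iff_exists.2 ⟨m, hcol⟩)
  refine ⟨n, hχ.symm, hm.mono ?_⟩
  have h := hcol.chromaticNumber_le
  rw [← hχ] at h
  exact_mod_cast h
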